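/- Let P be a T-invariant probability measure on Ω = ((ℝ^d))^ℤ such that the family of laws {P ∘ S_n^{-1} : n ≥ 0} on ℝ^d is tight. Then there exists a probability measure Γ on Ω × Ω that is invariant under the map S(x,y) = (Tx, x + y), invariant under the coordinatewise lifted shift (T × T)(x,y) = (Tx, Ty), and whose first marginal (pushforward under (x,y) ↦ x) equals P. -/

import Mathlib

open MeasureTheory

noncomputable section

abbrev VecD (d : ℕ) := Fin d → ℝ
abbrev SeqD (d : ℕ) := ℤ → VecD d

/-- The left shift on doubly infinite sequences. -/
def shiftT (d : ℕ) : SeqD d → SeqD d := fun x n => x (n + 1)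

/-- The map `D x = T x - x`. -/
def mapD (d : ℕ) : SeqD d → SeqD d := fun x => shiftT d x - x

/-- The partial sums `S_n`. -/
def Spart (d : ℕ) (n : ℤ) (x : SeqD d) : VecD d :=
  if 0 ≤ n then ∑ i ∈ Finset.range n.toNat, x ((i : ℤ) + 1)
  else -∑ i ∈ Finset.range (-n).toNat, x (n + 1 + (i : ℤ))

/-- Tightness of a family of measures. -/
def IsTightFamily {E ι : Type*} [TopologicalSpace E] {m : MeasurableSpace E}
    (μ : ι → Measure E) : Prop :=
  ∀ ε : ℝ, 0 < ε → ∃ K : Set E, IsCompact K ∧ ∀ i, 1 - ENNReal.ofReal ε ≤ μ i K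

/-- A `T`-invariant probability measure is null-homologous if it is the image under `D`
of a `T`-invariant probability measure. -/
def NullHomologous {d : ℕ} (P : Measure (SeqD d)) : Prop :=
  ∃ Q : Measure (SeqD d), IsProbabilityMeasure Q ∧ Q.map (shiftT d) = Q ∧ Q.map (mapD d) = P

/-- The maps `Λ_k`. -/
def Lam (d : ℕ) (k : ℕ) (x : SeqD d) : SeqD d × SeqD d :=
  ((shiftT d)^[k] x, ∑ i ∈ Finset.range k, (shiftT d)^[i] x)

/-- The map `S (x, y) = (T x, x + y)`. -/
def SMap (d : ℕ) : SeqD d × SeqD d → SeqD d × SeqD d := fun p => (shiftT d p.1, p.1 + p.2)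

open Filter Topology Set
open scoped ENNReal BoundedContinuousFunction

/-- A set of measures on a countable product is tight if all its marginals are. -/
theorem isTightMeasureSet_of_forall_map_eval {ι : Type*} [Countable ι] {X : ι → Type*}
    [∀ i, TopologicalSpace (X i)] [∀ i, MeasurableSpace (X i)] {A : Set (Measure (∀ i, X i))}
    (h : ∀ i, IsTightMeasureSet (Measure.map (Function.eval i) '' A)) :
    IsTightMeasureSet A := by
  rw [isTightMeasureSet_iff_exists_isCompact_measure_compl_le]
  intro ε hε
  obtain ⟨δ, hδ, hδε⟩ := ENNReal.exists_pos_sum_of_countable' hε.ne' ι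
  have hK (i : ι) : ∃ K : Set (X i), IsCompact K ∧
      ∀ μ ∈ A, μ.map (Function.eval i) Kᶜ ≤ δ i := by
    simpa using isTightMeasureSet_iff_exists_isCompact_measure_compl_le.1 (h i) (δ i) (hδ i)
  choose K hKc hK using hK
  refine ⟨univ.pi K, isCompact_univ_pi hKc, fun μ hμ => ?_⟩
  have hcompl : (univ.pi K)ᶜ = ⋃ i, Function.eval i ⁻¹' (K i)ᶜ := by
    ext x
    simp
  calc μ (univ.pi K)ᶜ ≤ ∑' i, μ (Function.eval i ⁻¹' (K i)ᶜ) := by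
        rw [hcompl]
        exact measure_iUnion_le _
    _ ≤ ∑' i, δ i := ENNReal.tsum_le_tsum fun i =>
        (Measure.le_map_apply (measurable_pi_apply i).aemeasurable _).trans (hK i μ hμ)
    _ ≤ ε := hδε.le

theorem IsTightFamily.isTightMeasureSet_range {E ι : Type*} [TopologicalSpace E] [T2Space E]
    [MeasurableSpace E] [OpensMeasurableSpace E] {μ : ι → Measure E}
    [∀ i, IsProbabilityMeasure (μ i)] (h : IsTightFamily μ) :
    IsTightMeasureSet (range μ) := by
  rw [isTightMeasureSet_iff_exists_isCompact_measure_compl_le]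
  intro ε hε
  obtain rfl | hε_top := eq_or_ne ε ⊤
  · exact ⟨∅, isCompact_empty, by simp⟩
  obtain ⟨K, hKc, hK⟩ := h ε.toReal (ENNReal.toReal_pos hε.ne' hε_top)
  refine ⟨K, hKc, ?_⟩
  rintro _ ⟨i, rfl⟩
  rw [prob_compl_eq_one_sub hKc.measurableSet]
  have hi := hK i
  rw [ENNReal.ofReal_toReal hε_top] at hi
  rw [tsub_le_iff_right] at hi ⊢
  rwa [add_comm]

section CesaroMeasure

variable {X Y : Type*} [MeasurableSpace X] [MeasurableSpace Y]

/-- The average of the first `n + 1` terms of a sequence of measures. -/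
def cesaroMeasure (μ : ℕ → Measure X) (n : ℕ) : Measure X :=
  ((n + 1 : ℕ) : ℝ≥0∞)⁻¹ • ∑ k ∈ Finset.range (n + 1), μ k

theorem cesaroMeasure_apply_le {μ : ℕ → Measure X} {s : Set X} {c : ℝ≥0∞}
    (h : ∀ k, μ k s ≤ c) (n : ℕ) : cesaroMeasure μ n s ≤ c := by
  rw [cesaroMeasure, Measure.smul_apply, Measure.finsetSum_apply, smul_eq_mul]
  calc ((n + 1 : ℕ) : ℝ≥0∞)⁻¹ * ∑ k ∈ Finset.range (n + 1), μ k s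
      ≤ ((n + 1 : ℕ) : ℝ≥0∞)⁻¹ * (((n + 1 : ℕ) : ℝ≥0∞) * c) := by
        gcongr
        simpa using Finset.sum_le_card_nsmul (Finset.range (n + 1)) _ c fun k _ => h k
    _ = c := by
        rw [← mul_assoc, ENNReal.inv_mul_cancel (by simp) (by simp), one_mul]

theorem cesaroMeasure_const (μ : Measure X) (n : ℕ) : cesaroMeasure (fun _ => μ) n = μ := by
  rw [cesaroMeasure, Finset.sum_const, Finset.card_range, ← Nat.cast_smul_eq_nsmul ℝ≥0∞,
    smul_smul, ENNReal.inv_mul_cancel (by simp) (by simp), one_smul]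

instance (μ : ℕ → Measure X) [∀ k, IsProbabilityMeasure (μ k)] (n : ℕ) :
    IsProbabilityMeasure (cesaroMeasure μ n) where
  measure_univ := by
    rw [cesaroMeasure, Measure.smul_apply, Measure.finsetSum_apply, smul_eq_mul]
    simp only [measure_univ, Finset.sum_const, Finset.card_range, nsmul_eq_mul, mul_one]
    exact ENNReal.inv_mul_cancel (by simp) (by simp)

theorem map_cesaroMeasure {g : X → Y} (hg : Measurable g) (μ : ℕ → Measure X) (n : ℕ) :
    (cesaroMeasure μ n).map g = cesaroMeasure (fun k => (μ k).map g) n := by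
  ext s hs
  simp [cesaroMeasure, Measure.map_apply hg hs, Measure.finsetSum_apply]

theorem isTightMeasureSet_range_cesaroMeasure [TopologicalSpace X] {μ : ℕ → Measure X}
    (h : IsTightMeasureSet (range μ)) : IsTightMeasureSet (range (cesaroMeasure μ)) := by
  rw [isTightMeasureSet_iff_exists_isCompact_measure_compl_le] at h ⊢
  intro ε hε
  obtain ⟨K, hKc, hK⟩ := h ε hε
  refine ⟨K, hKc, ?_⟩
  rintro _ ⟨n, rfl⟩
  exact cesaroMeasure_apply_le (fun k => hK _ (mem_range_self k)) n

theorem integral_cesaroMeasure [TopologicalSpace X] [OpensMeasurableSpace X]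
    (μ : ℕ → Measure X) [∀ k, IsProbabilityMeasure (μ k)] (φ : X →ᵇ ℝ) (n : ℕ) :
    ∫ x, φ x ∂(cesaroMeasure μ n) =
      ((n : ℝ) + 1)⁻¹ * ∑ k ∈ Finset.range (n + 1), ∫ x, φ x ∂(μ k) := by
  rw [cesaroMeasure, integral_smul_measure, integral_finsetSum_measure fun k _ => φ.integrable _]
  simp [ENNReal.toReal_add]

/-- `cesaroMeasure` as a sequence of bundled probability measures. -/
def cesaroProbabilityMeasure (μ : ℕ → Measure X) [∀ k, IsProbabilityMeasure (μ k)] (n : ℕ) :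
    ProbabilityMeasure X :=
  ⟨cesaroMeasure μ n, inferInstance⟩

/-- **Krylov–Bogolyubov**: a tight orbit of probability measures under a continuous map has an
invariant probability measure in the closure of its Cesàro averages. -/
theorem exists_map_eq_self_mem_closure_cesaroMeasure [TopologicalSpace X] [T2Space X]
    [BorelSpace X] [HasOuterApproxClosed X] {f : X → X} (hf : Continuous f)
    (μ : ℕ → Measure X) [∀ k, IsProbabilityMeasure (μ k)]
    (hμ : ∀ k, μ (k + 1) = (μ k).map f) (htight : IsTightMeasureSet (range μ)) :
    ∃ Γ : ProbabilityMeasure X, (Γ : Measure X).map f = Γ ∧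
      Γ ∈ closure (range (cesaroProbabilityMeasure μ)) := by
  set C := cesaroProbabilityMeasure μ with hC
  have hcompact : IsCompact (closure (range C)) := by
    apply isCompact_closure_of_isTightMeasureSet
    refine (isTightMeasureSet_range_cesaroMeasure htight).subset ?_
    rintro _ ⟨_, ⟨n, rfl⟩, rfl⟩
    exact ⟨n, rfl⟩
  obtain ⟨Γ, hΓ, hlim⟩ := hcompact.ultrafilter_le_nhds ((hyperfilter ℕ).map C) (by
    simp only [Ultrafilter.coe_map, le_principal_iff]
    exact mem_map.2 (univ_mem' fun n => subset_closure (mem_range_self n)))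
  replace hlim : Tendsto C (hyperfilter ℕ : Filter ℕ) (𝓝 Γ) := hlim
  refine ⟨Γ, ?_, hΓ⟩
  have : IsProbabilityMeasure ((Γ : Measure X).map f) :=
    Measure.isProbabilityMeasure_map hf.measurable.aemeasurable
  apply ext_of_forall_integral_eq_of_IsFiniteMeasure
  intro φ
  rw [integral_map hf.measurable.aemeasurable φ.continuous.aestronglyMeasurable]
  have hint := ProbabilityMeasure.tendsto_iff_forall_integral_tendsto.1 hlim
  have hφ := hint φ
  have hφf := hint (φ.compContinuous ⟨f, hf⟩)
  have hdiff (n : ℕ) : ∫ x, φ (f x) ∂(C n : Measure X) - ∫ x, φ x ∂(C n : Measure X) =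
      ((n : ℝ) + 1)⁻¹ * (∫ x, φ x ∂(μ (n + 1)) - ∫ x, φ x ∂(μ 0)) := by
    have hstep (k : ℕ) : ∫ x, φ (f x) ∂(μ k) = ∫ x, φ x ∂(μ (k + 1)) := by
      rw [hμ, integral_map hf.measurable.aemeasurable φ.continuous.aestronglyMeasurable]
    have h₁ := integral_cesaroMeasure μ (φ.compContinuous ⟨f, hf⟩) n
    have h₂ := integral_cesaroMeasure μ φ n
    simp only [BoundedContinuousFunction.compContinuous_apply, ContinuousMap.coe_mk, hstep] at h₁
    simp only [hC, cesaroProbabilityMeasure, ProbabilityMeasure.coe_mk, h₁, h₂]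
    rw [← mul_sub, ← Finset.sum_sub_distrib, Finset.sum_range_sub fun k => ∫ x, φ x ∂(μ k)]
  have hbound (k : ℕ) : ‖∫ x, φ x ∂(μ k)‖ ≤ ‖φ‖ := by
    simpa using φ.norm_integral_le_norm (μ := μ k)
  have hzero : Tendsto (fun n => ∫ x, φ (f x) ∂(C n : Measure X) - ∫ x, φ x ∂(C n : Measure X))
      atTop (𝓝 0) := by
    simp only [hdiff]
    refine squeeze_zero_norm (a := fun n : ℕ => 1 / ((n : ℝ) + 1) * (‖φ‖ + ‖φ‖)) (fun n => ?_) ?_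
    · rw [norm_mul, norm_inv, Real.norm_of_nonneg (by positivity), ← one_div]
      gcongr
      exact (norm_sub_le _ _).trans (add_le_add (hbound _) (hbound _))
    · simpa using tendsto_one_div_add_atTop_nhds_zero_nat.mul_const (‖φ‖ + ‖φ‖)
  exact sub_eq_zero.1 (tendsto_nhds_unique (hφf.sub hφ)
    (hzero.mono_left Nat.hyperfilter_le_atTop))

end CesaroMeasure

theorem continuous_shiftT (d : ℕ) : Continuous (shiftT d) :=
  continuous_pi fun n => continuous_apply (n + 1)

theorem continuous_SMap (d : ℕ) : Continuous (SMap d) :=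
  ((continuous_shiftT d).comp continuous_fst).prodMk (continuous_fst.add continuous_snd)

theorem continuous_Lam (d k : ℕ) : Continuous (Lam d k) :=
  ((continuous_shiftT d).iterate k).prodMk
    (continuous_finsetSum _ fun i _ => (continuous_shiftT d).iterate i)

theorem continuous_Spart_natCast (d n : ℕ) : Continuous (Spart d n) := by
  unfold Spart
  simp only [Nat.cast_nonneg, if_true]
  fun_prop

theorem shiftT_iterate_apply (d i : ℕ) (x : SeqD d) (n : ℤ) :
    (shiftT d)^[i] x n = x (n + i) := by
  induction i generalizing x with
  | zero => simp
  | succ i ih =>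
    rw [Function.iterate_succ_apply, ih, shiftT]
    congr 1
    push_cast
    ring

theorem SMap_comp_Lam (d k : ℕ) : SMap d ∘ Lam d k = Lam d (k + 1) := by
  funext x
  simp [SMap, Lam, Finset.sum_range_succ, add_comm, Function.iterate_succ_apply']

theorem prodMap_shiftT_comp_Lam (d k : ℕ) :
    Prod.map (shiftT d) (shiftT d) ∘ Lam d k = Lam d k ∘ shiftT d := by
  funext x
  refine Prod.ext ?_ ?_
  · exact (Function.Commute.refl (shiftT d)).iterate_right k x
  · funext n
    simp only [Lam, Function.comp_apply, Prod.map_snd]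
    simp only [shiftT, Finset.sum_apply, shiftT_iterate_apply]
    exact Finset.sum_congr rfl fun i _ => by rw [add_right_comm]

theorem eval_one_snd_Lam (d k : ℕ) (x : SeqD d) : (Lam d k x).2 1 = Spart d k x := by
  simp [Lam, Spart, shiftT_iterate_apply, add_comm]

theorem map_iterate_eq_self {X : Type*} [MeasurableSpace X] {μ : Measure X} {f : X → X}
    (hf : Measurable f) (h : μ.map f = μ) (k : ℕ) : μ.map f^[k] = μ :=
  ((⟨hf, h⟩ : MeasurePreserving f μ μ).iterate k).map_eq

theorem map_shiftT_map_Lam {d : ℕ} {P : Measure (SeqD d)} (hT : P.map (shiftT d) = P) (k : ℕ) :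
    (P.map (Lam d k)).map (Prod.map (shiftT d) (shiftT d)) = P.map (Lam d k) := by
  have hTm := (continuous_shiftT d).measurable
  have hL := (continuous_Lam d k).measurable
  rw [Measure.map_map (hTm.prodMap hTm) hL, prodMap_shiftT_comp_Lam,
    ← Measure.map_map hL hTm, hT]

theorem map_fst_map_Lam {d : ℕ} {P : Measure (SeqD d)} (hT : P.map (shiftT d) = P) (k : ℕ) :
    (P.map (Lam d k)).map Prod.fst = P := by
  rw [Measure.map_map measurable_fst (continuous_Lam d k).measurable]
  exact map_iterate_eq_self (continuous_shiftT d).measurable hT k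

/-- Every coordinate of the second component of `Lam d k` has the law of the `k`-th partial sum. -/
theorem map_eval_map_snd_map_Lam {d : ℕ} {P : Measure (SeqD d)} (hT : P.map (shiftT d) = P)
    (k : ℕ) (m : ℤ) :
    ((P.map (Lam d k)).map Prod.snd).map (Function.eval m) = P.map (Spart d k) := by
  have hTm := (continuous_shiftT d).measurable
  set ν := (P.map (Lam d k)).map Prod.snd with hν
  have hνT : ν.map (shiftT d) = ν := by
    nth_rw 2 [hν]
    rw [← map_shiftT_map_Lam hT k, Measure.map_map measurable_snd (hTm.prodMap hTm), hν,
      Measure.map_map hTm measurable_snd]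
    rfl
  have hstep (m : ℤ) : ν.map (Function.eval (m + 1)) = ν.map (Function.eval m) := by
    nth_rw 2 [← hνT]
    rw [Measure.map_map (measurable_pi_apply m) hTm]
    rfl
  have hone : ν.map (Function.eval 1) = P.map (Spart d k) := by
    rw [hν, Measure.map_map measurable_snd (continuous_Lam d k).measurable,
      Measure.map_map (measurable_pi_apply 1)
        (measurable_snd.comp (continuous_Lam d k).measurable)]
    congr 1
    exact funext (eval_one_snd_Lam d k)
  rw [← hone]
  induction m using Int.induction_on with
  | zero => exact (hstep 0).symm
  | succ i ih => rw [hstep, ih]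
  | pred i ih => rw [← ih, ← hstep, sub_add_cancel]

theorem isTightMeasureSet_range_map_Lam {d : ℕ} {P : Measure (SeqD d)} [IsProbabilityMeasure P]
    (hT : P.map (shiftT d) = P) (htight : IsTightFamily (fun n : ℕ => P.map (Spart d n))) :
    IsTightMeasureSet (range fun k => P.map (Lam d k)) := by
  have (n : ℕ) : IsProbabilityMeasure (P.map (Spart d n)) :=
    Measure.isProbabilityMeasure_map (continuous_Spart_natCast d n).measurable.aemeasurable
  refine IsTightMeasureSet.prodMk ?_ (isTightMeasureSet_of_forall_map_eval fun m => ?_)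
  · refine (isTightMeasureSet_singleton (μ := P)).subset ?_
    rintro _ ⟨_, ⟨k, rfl⟩, rfl⟩
    exact map_fst_map_Lam hT k
  · refine htight.isTightMeasureSet_range.subset ?_
    rintro _ ⟨_, ⟨_, ⟨k, rfl⟩, rfl⟩, rfl⟩
    exact ⟨k, (map_eval_map_snd_map_Lam hT k m).symm⟩

/-- If the family of laws of `S_n`, `n ≥ 0`, under a `T`-invariant probability measure `P`
is tight, then there is a probability measure `Γ` on `Ω × Ω` invariant under
`S(x,y) = (Tx, x+y)` and under `T × T`, whose first marginal equals `P`. -/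
theorem exists_sMap_invariant_measure (d : ℕ) (hd : 1 ≤ d) (P : Measure (SeqD d))
    [IsProbabilityMeasure P] (hT : P.map (shiftT d) = P)
    (htight : IsTightFamily (fun n : ℕ => P.map (Spart d n))) :
    ∃ Γ : Measure (SeqD d × SeqD d), IsProbabilityMeasure Γ ∧
      Γ.map (SMap d) = Γ ∧ Γ.map (Prod.map (shiftT d) (shiftT d)) = Γ ∧
      Γ.map Prod.fst = P := by
  have hTm := continuous_shiftT d
  have (k : ℕ) : IsProbabilityMeasure (P.map (Lam d k)) :=
    Measure.isProbabilityMeasure_map (continuous_Lam d k).measurable.aemeasurable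
  obtain ⟨Γ, hΓ, hcl⟩ := exists_map_eq_self_mem_closure_cesaroMeasure (continuous_SMap d)
    (fun k => P.map (Lam d k))
    (fun k => by
      rw [Measure.map_map (continuous_SMap d).measurable (continuous_Lam d k).measurable,
        SMap_comp_Lam])
    (isTightMeasureSet_range_map_Lam hT htight)
  refine ⟨Γ, inferInstance, hΓ, ?_, ?_⟩
  · have hclosed := isClosed_eq (ProbabilityMeasure.continuous_map (hTm.prodMap hTm))
      continuous_id
    refine congrArg ProbabilityMeasure.toMeasure (closure_minimal ?_ hclosed hcl)
    rintro _ ⟨n, rfl⟩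
    apply Subtype.ext
    change (cesaroMeasure _ n).map _ = cesaroMeasure _ n
    simp only [map_cesaroMeasure (hTm.prodMap hTm).measurable, map_shiftT_map_Lam hT]
  · let P₀ : ProbabilityMeasure (SeqD d) := ⟨P, inferInstance⟩
    have hclosed := isClosed_eq
      (ProbabilityMeasure.continuous_map (continuous_fst (X := SeqD d) (Y := SeqD d)))
      (continuous_const (y := P₀))
    refine congrArg ProbabilityMeasure.toMeasure (closure_minimal ?_ hclosed hcl)
    rintro _ ⟨n, rfl⟩
    apply Subtype.ext
    change (cesaroMeasure _ n).map _ = P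
    simp only [map_cesaroMeasure measurable_fst, map_fst_map_Lam hT, cesaroMeasure_const]
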